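/- arXiv:2501.07031 — 3 statements merged into one kernel-verified Lean document; each statement's English description precedes it below -/
import Mathlib

section
/- Fix o ∈ ℂ and define Φ_o : (ℂ × Circle) × (ℂ × Circle) → ℝ by Φ_o((x, a), (y, b)) = −s(o, x, y) + s(o, (x−y)·b + y, y). Then Φ_o is a quandle 2-cocycle of Rot E²: (QC1) for all p, q, r ∈ ℂ × Circle, Φ_o(p, q) + Φ_o(p ∗ q, r) − Φ_o(p, r) − Φ_o(p ∗ r, q ∗ r) = 0, and (QC2) Φ_o(p, p) = 0 for all p ∈ ℂ × Circle. -/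
/-- The quandle operation on `ℂ × Circle` (the quandle `Rot E²`):
`(z, a) ∗ (w, b) = ((z - w)·b + w, a)`. -/
noncomputable def rotOp (x y : ℂ × Circle) : ℂ × Circle :=
  ((x.1 - y.1) * (y.2 : ℂ) + y.1, x.2)

/-- The signed area of the triangle `(x, y, z)` in `ℂ`:
`s(x, y, z) = (1/2)·Im(conj(y − x)·(z − x))`. -/
noncomputable def signedArea (x y z : ℂ) : ℝ :=
  (1 / 2) * ((starRingEnd ℂ) (y - x) * (z - x)).im

/-- The map `Φ_o((x,a),(y,b)) = −s(o,x,y) + s(o,(x−y)·b + y, y)`. -/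
noncomputable def Phi (o : ℂ) (p q : ℂ × Circle) : ℝ :=
  - signedArea o p.1 q.1 + signedArea o ((p.1 - q.1) * (q.2 : ℂ) + q.1) q.1

/-- `Φ_o` is a quandle 2-cocycle of `Rot E²`: it satisfies the cocycle condition
(QC1) and vanishes on the diagonal (QC2). -/
theorem Phi_is_quandle_2_cocycle (o : ℂ) :
    (∀ p q r : ℂ × Circle,
      Phi o p q + Phi o (rotOp p q) r - Phi o p r - Phi o (rotOp p r) (rotOp q r) = 0) ∧
    (∀ p : ℂ × Circle, Phi o p p = 0) := by
  refine ⟨?_, fun p => by simp [Phi]⟩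
  rintro ⟨x, a⟩ ⟨y, b⟩ ⟨z, c⟩
  have hc : (c : ℂ).re * (c : ℂ).re + (c : ℂ).im * (c : ℂ).im = 1 := by
    rw [← Complex.normSq_apply, Circle.normSq_coe]
  -- The terms quadratic in `c` are `|c|²` times `Φ_z((x, a), (y, b))`.
  simp only [Phi, rotOp, signedArea, Complex.add_re, Complex.add_im, Complex.sub_re,
    Complex.sub_im, Complex.mul_re, Complex.mul_im, Complex.conj_re, Complex.conj_im]
  generalize (c : ℂ).re = c₁, (c : ℂ).im = c₂ at *
  generalize (b : ℂ).re = b₁, (b : ℂ).im = b₂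
  linear_combination
    (1 / 2) * (((x.re - z.re) * (y.im - z.im) - (x.im - z.im) * (y.re - z.re)) -
      (((x.re - y.re) * b₁ - (x.im - y.im) * b₂ + y.re - z.re) * (y.im - z.im) -
       ((x.re - y.re) * b₂ + (x.im - y.im) * b₁ + y.im - z.im) * (y.re - z.re))) * hc
end

section
/- For all o, x, y, z ∈ ℂ and all b, c ∈ Circle and any a ∈ Circle, writing p = (x,a), q = (y,b), r = (z,c) ∈ ℂ × Circle, one has Φ_o(p, q) + Φ_o(p ∗ q, r) − Φ_o(p, r) − Φ_o(p ∗ r, q ∗ r) = (s∘∂)(o, x, y, z) + (s∘∂)(o, ((x−y)b + y − z)c + z, (y−z)c + z, z) − (s∘∂)(o, (x−y)b + y, y, z) − (s∘∂)(o, (x−z)c + z, (y−z)c + z, z), where (s∘∂)(x, y, z, w) = s(y, z, w) − s(x, z, w) + s(x, y, w) − s(x, y, z). -/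
/-- `(s ∘ ∂)(x, y, z, w) = s(y,z,w) − s(x,z,w) + s(x,y,w) − s(x,y,z)`. -/
noncomputable def sBoundary (x y z w : ℂ) : ℝ :=
  signedArea y z w - signedArea x z w + signedArea x y w - signedArea x y z

/-- Signed area is invariant under the rotation by `u` about the third vertex. -/
theorem signedArea_rotate_about_third (x y z : ℂ) (u : Circle) :
    signedArea ((x - z) * (u : ℂ) + z) ((y - z) * (u : ℂ) + z) z = signedArea x y z := by
  have hu : (starRingEnd ℂ) (u : ℂ) * (u : ℂ) = 1 := by
    rw [← Complex.normSq_eq_conj_mul_self, Circle.normSq_coe, Complex.ofReal_one]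
  unfold signedArea
  congr 2
  simp only [map_sub, map_add, map_mul]
  linear_combination
    ((starRingEnd ℂ) y - (starRingEnd ℂ) x) * (z - x) * hu

/-- The quandle 2-cocycle expression for `Φ_o` equals an explicit alternating sum of
values of `s ∘ ∂`. -/
theorem Phi_cocycle_eq_sBoundary (o x y z : ℂ) (a b c : Circle) :
    Phi o (x, a) (y, b) + Phi o (rotOp (x, a) (y, b)) (z, c)
      - Phi o (x, a) (z, c) - Phi o (rotOp (x, a) (z, c)) (rotOp (y, b) (z, c)) =
    sBoundary o x y z
      + sBoundary o (((x - y) * (b : ℂ) + y - z) * (c : ℂ) + z) ((y - z) * (c : ℂ) + z) z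
      - sBoundary o ((x - y) * (b : ℂ) + y) y z
      - sBoundary o ((x - z) * (c : ℂ) + z) ((y - z) * (c : ℂ) + z) z := by
  have hx := signedArea_rotate_about_third x y z c
  have hxb := signedArea_rotate_about_third ((x - y) * (b : ℂ) + y) y z c
  have hdist : ((x - z) * (c : ℂ) + z - ((y - z) * (c : ℂ) + z)) * (b : ℂ)
      + ((y - z) * (c : ℂ) + z) = ((x - y) * (b : ℂ) + y - z) * (c : ℂ) + z := by ring
  simp only [Phi, rotOp, sBoundary, hdist]
  linarith
end

section
/- Let n ≥ 1 and let ζ_n = exp(2π√−1/n) ∈ ℂ. For α ∈ ℤ[ζ_n], one has α · conj(α) = 1 if and only if α = ±ζ_n^k for some k with 0 ≤ k ≤ n−1. In other words, the kernel of the norm map from the unit group of ℤ[ζ_n] to the unit group of the ring of integers of ℚ(ζ_n + ζ_n^{−1}), given by α ↦ α·conj(α) = |α|², consists exactly of the roots of unity of ℚ(ζ_n). -/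
open Polynomial in
/-- A polynomial value at `z` and at `z⁻¹`, with `z` a root of unity, being mutually inverse forces
the value at `z` to have absolute value one under every complex embedding. -/
theorem norm_map_aeval_eq_one_of_mul_aeval_inv {K : Type*} [Field K] {z : K} {n : ℕ} (hn : n ≠ 0)
    (hz : z ^ n = 1) (p : ℤ[X]) (h : aeval z p * aeval z⁻¹ p = 1) (φ : K →+* ℂ) :
    ‖φ (aeval z p)‖ = 1 := by
  have hinv : (starRingEnd ℂ) (φ z) = φ z⁻¹ := by
    rw [map_inv₀, Complex.inv_eq_conj
      (Complex.norm_eq_one_of_pow_eq_one (by rw [← map_pow, hz, map_one]) hn)]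
  have hmap (ψ : K →+* ℂ) (w : K) : ψ (aeval w p) = aeval (ψ w) p :=
    (aeval_algHom_apply ψ.toIntAlgHom w p).symm
  have hconj : (starRingEnd ℂ) (φ (aeval z p)) = φ (aeval z⁻¹ p) := by
    rw [hmap φ z⁻¹, ← hinv]
    exact hmap ((starRingEnd ℂ).comp φ) z
  have hmul : φ (aeval z p) * (starRingEnd ℂ) (φ (aeval z p)) = 1 := by
    rw [hconj, ← map_mul, h, map_one]
  rw [Complex.mul_conj'] at hmul
  exact (pow_eq_one_iff_of_nonneg (norm_nonneg _) two_ne_zero).1 (by exact_mod_cast hmul)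

/-- The roots of unity of the `n`-th cyclotomic field are the elements `± z ^ k` with `k < n`,
where `z` is a primitive `n`-th root of unity. -/
theorem IsPrimitiveRoot.exists_eq_pow_or_eq_neg_pow_of_isOfFinOrder {K : Type*} [Field K]
    [NumberField K] {n : ℕ} [NeZero n] [IsCyclotomicExtension {n} ℚ K] {z x : K}
    (hz : IsPrimitiveRoot z n) (hx : IsOfFinOrder x) :
    ∃ k < n, x = z ^ k ∨ x = -z ^ k := by
  rcases Nat.even_or_odd n with he | ho
  · have htor := IsCyclotomicExtension.Rat.torsionOrder_eq (n := n) (K := K)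
    rw [if_pos he] at htor
    have hdvd : orderOf x ∣ n := by
      have : NeZero (orderOf x) := ⟨hx.orderOf_pos.ne'⟩
      exact htor ▸ NumberField.Units.dvd_torsionOrder_of_isPrimitiveRoot (IsPrimitiveRoot.orderOf x)
    obtain ⟨k, hk, h⟩ := hz.eq_pow_of_pow_eq_one (orderOf_dvd_iff_pow_eq_one.1 hdvd)
    exact ⟨k, hk, Or.inl h.symm⟩
  · exact hz.exists_pow_or_neg_mul_pow_of_isOfFinOrder ho hx

/-- An element `α` of `ℤ[ζ_n]` satisfies `α · conj(α) = 1` (i.e. lies in the kernel of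
the relative norm map to the maximal real subfield) if and only if `α = ±ζ_n^k` for
some `0 ≤ k ≤ n − 1`, i.e. iff `α` is a root of unity of `ℚ(ζ_n)`. -/
theorem norm_one_iff_root_of_unity (n : ℕ) (hn : 1 ≤ n)
    (ζ : ℂ) (hζ : ζ = Complex.exp (2 * Real.pi * Complex.I / n)) :
    ∀ α ∈ Algebra.adjoin ℤ ({ζ} : Set ℂ),
      (α * (starRingEnd ℂ) α = 1 ↔ ∃ k : ℕ, k ≤ n - 1 ∧ (α = ζ ^ k ∨ α = -ζ ^ k)) := by
  have : NeZero n := ⟨by omega⟩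
  have hprim : IsPrimitiveRoot ζ n := hζ ▸ Complex.isPrimitiveRoot_exp n (NeZero.ne n)
  have hnorm : ‖ζ‖ = 1 := hprim.norm'_eq_one (NeZero.ne n)
  intro α hα
  constructor
  · intro h
    have : IsCyclotomicExtension {n} ℚ (IntermediateField.adjoin ℚ {ζ}) := by
      change IsCyclotomicExtension {n} ℚ (IntermediateField.adjoin ℚ {ζ}).toSubalgebra
      rw [IntermediateField.adjoin_simple_toSubalgebra_of_isAlgebraic
        (hprim.isIntegral (NeZero.pos n)).tower_top.isAlgebraic]
      exact hprim.adjoin_isCyclotomicExtension ℚ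
    have : NumberField (IntermediateField.adjoin ℚ {ζ}) :=
      IsCyclotomicExtension.numberField {n} ℚ _
    let z : IntermediateField.adjoin ℚ {ζ} := IntermediateField.AdjoinSimple.gen ℚ ζ
    have hz : IsPrimitiveRoot z n := IsPrimitiveRoot.coe_submonoidClass_iff.1 hprim
    let ι : IntermediateField.adjoin ℚ {ζ} →+* ℂ := algebraMap _ ℂ
    have hιz : ι z = ζ := rfl
    rw [Algebra.adjoin_singleton_eq_range_aeval] at hα
    obtain ⟨p, rfl⟩ := hα
    have hmap (w) : ι (Polynomial.aeval w p) = Polynomial.aeval (ι w) p :=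
      (Polynomial.aeval_algHom_apply ι.toIntAlgHom w p).symm
    have hconj : (starRingEnd ℂ) (Polynomial.aeval ζ p) = Polynomial.aeval ζ⁻¹ p := by
      rw [Complex.inv_eq_conj hnorm]
      exact (Polynomial.aeval_algHom_apply (starRingEnd ℂ).toIntAlgHom ζ p).symm
    have hinv : Polynomial.aeval z p * Polynomial.aeval z⁻¹ p = 1 := by
      apply ι.injective
      rw [map_mul, hmap, hmap, map_inv₀, hιz, map_one, ← hconj]
      exact h
    have hxi : IsIntegral ℤ (Polynomial.aeval z p) :=
      IsIntegral.of_mem_of_fg _ (hz.isIntegral (NeZero.pos n)).fg_adjoin_singleton _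
        (Polynomial.aeval_mem_adjoin_singleton ℤ z)
    obtain ⟨m, hm, hpow⟩ := NumberField.Embeddings.pow_eq_one_of_norm_eq_one _ ℂ hxi
      (norm_map_aeval_eq_one_of_mul_aeval_inv (NeZero.ne n) hz.pow_eq_one p hinv)
    obtain ⟨k, hk, hk'⟩ := hz.exists_eq_pow_or_eq_neg_pow_of_isOfFinOrder
      (isOfFinOrder_iff_pow_eq_one.2 ⟨m, hm, hpow⟩)
    refine ⟨k, by omega, hk'.imp (fun e ↦ ?_) (fun e ↦ ?_)⟩
    · simpa [hmap, hιz] using congrArg ι e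
    · simpa [hmap, hιz] using congrArg ι e
  · rintro ⟨k, -, rfl | rfl⟩ <;>
      simp [← mul_pow, Complex.mul_conj', hnorm]
end
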